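/- Let N ≥ 2, let 1 ≤ m < N, let p ≥ 2 be a real number, let θ ∈ ℝ, and write points of ℝ^N = ℝ^m × ℝ^{N−m} as (ξ, η) with ξ ∈ ℝ^m, η ∈ ℝ^{N−m}. Let Ω ⊆ (ℝ^m \ {0}) × ℝ^{N−m} be an open set. Then for every u ∈ C^∞_c(Ω;ℂ): ∫_Ω |∇_ξ u(ξ,η)·(ξ/|ξ|)|^p |ξ|^{−p(θ−1)} dξ dη ≥ |(m − pθ)/p|^p ∫_Ω |u(ξ,η)|^p |ξ|^{−pθ} dξ dη. -/

import Mathlib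

open MeasureTheory Real

noncomputable section

lemma young_aux {p c a b : ℝ} (hp : 2 ≤ p) (hc : 0 ≤ c) (ha : 0 ≤ a) (hb : 0 ≤ b) :
    p * (c ^ (p - 1) * (a ^ (p - 1) * b)) ≤ (p - 1) * (c ^ p * a ^ p) + b ^ p := by
  have hpq : p.HolderConjugate (p / (p - 1)) := Real.HolderConjugate.conjExponent (by linarith)
  have h := Real.young_inequality_of_nonneg hb (b := (c * a) ^ (p - 1)) (by positivity) hpq
  rw [← Real.rpow_mul (by positivity), mul_div_cancel₀ _ (by linarith : p - 1 ≠ 0),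
    Real.mul_rpow hc ha, Real.mul_rpow hc ha] at h
  have hp0 : 0 < p := by linarith
  have h2 := mul_le_mul_of_nonneg_left h hp0.le
  have e : p * (b ^ p / p + c ^ p * a ^ p / (p / (p - 1)))
      = (p - 1) * (c ^ p * a ^ p) + b ^ p := by
    have : p - 1 ≠ 0 := by linarith
    field_simp
    ring
  rw [e] at h2
  calc _ = p * (b * (c ^ (p - 1) * a ^ (p - 1))) := by ring
    _ ≤ _ := h2

lemma cont_aux {X : Type*} [TopologicalSpace X] {u : X → ℂ} {f : X → ℝ}
    (h1 : ∀ q ∈ tsupport u, ContinuousAt f q) (h2 : ∀ q, q ∉ tsupport u → f q = 0) :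
    Continuous f := by
  rw [continuous_iff_continuousAt]
  intro q
  by_cases hq : q ∈ tsupport u
  · exact h1 q hq
  · have : f =ᶠ[nhds q] fun _ => 0 := by
      filter_upwards [(isClosed_tsupport u).isOpen_compl.mem_nhds hq] with x hx using h2 x hx
    exact continuousAt_const.congr this.symm

section
variable {m k : ℕ}
local notation "E" => EuclideanSpace ℝ (Fin m)
local notation "V" => EuclideanSpace ℝ (Fin m) × EuclideanSpace ℝ (Fin k)

lemma euler_int (F : V → ℝ) (hF : ContDiff ℝ 1 F) (hc : HasCompactSupport F) :
    ∫ q, fderiv ℝ F q (q.1, 0) = - (m * ∫ q, F q) := by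
  haveI : (volume : Measure V).IsAddHaarMeasure := by
    rw [Measure.volume_eq_prod]; infer_instance
  have hcont := hF.continuous
  have hfd : Continuous (fderiv ℝ F) := hF.continuous_fderiv one_ne_zero
  have key : ∀ i : Fin m, Integrable (fun q : V =>
      q.1 i * fderiv ℝ F q (EuclideanSpace.single i 1, 0)) ∧
      ∫ q : V, q.1 i * fderiv ℝ F q (EuclideanSpace.single i 1, 0) = - ∫ q, F q := by
    intro i
    have hL : ∀ q : V, HasFDerivAt (fun q : V => q.1 i)
        ((EuclideanSpace.proj (𝕜 := ℝ) i).comp (ContinuousLinearMap.fst ℝ E (EuclideanSpace ℝ (Fin k)))) q :=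
      fun q => ((EuclideanSpace.proj (𝕜 := ℝ) i).comp
        (ContinuousLinearMap.fst ℝ E (EuclideanSpace ℝ (Fin k)))).hasFDerivAt
    have hci : Continuous (fun q : V => q.1 i) := by fun_prop
    have hI : Integrable (fun q : V =>
      q.1 i * fderiv ℝ F q (EuclideanSpace.single i 1, 0)) := by
      apply Continuous.integrable_of_hasCompactSupport
      · exact hci.mul (hfd.clm_apply continuous_const)
      · exact (hc.fderiv_apply ℝ _).mul_left
    refine ⟨hI, ?_⟩
    rw [integral_mul_fderiv_eq_neg_fderiv_mul_of_integrable _ hI]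
    · simp [(hL _).fderiv]
    · exact (hci.mul hcont).integrable_of_hasCompactSupport hc.mul_left
    · exact fun x _ => (hL x).differentiableAt
    · exact fun x _ => hF.differentiable one_ne_zero x
    · simp only [(hL _).fderiv]
      simpa using hcont.integrable_of_hasCompactSupport hc
  have e : ∀ q : V, fderiv ℝ F q (q.1, 0)
      = ∑ i, q.1 i * fderiv ℝ F q (EuclideanSpace.single i 1, 0) := by
    intro q
    have : ((q.1, 0) : V) = ∑ i, q.1 i • ((EuclideanSpace.single i (1:ℝ), 0) : V) := by
      ext j
      · simp [Prod.fst_sum, Pi.single_apply]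
      · simp [Prod.snd_sum]
    conv_lhs => rw [this]
    simp only [map_sum, map_smul, smul_eq_mul]
  simp_rw [e]
  rw [integral_finsetSum _ (fun i _ => (key i).1)]
  simp [(key _).2]

lemma deriv_aux {p s : ℝ} (hp : 2 ≤ p) {u : V → ℂ} (hu : Differentiable ℝ u) {q : V}
    (hq : q.1 ≠ 0) :
    fderiv ℝ (fun q : V => ‖u q‖ ^ p * ‖q.1‖ ^ s) q (q.1, 0)
      = p * ‖u q‖ ^ (p - 2) * inner ℝ (u q) (fderiv ℝ u q (q.1, 0)) * ‖q.1‖ ^ s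
        + s * (‖u q‖ ^ p * ‖q.1‖ ^ s) := by
  have h1 : HasFDerivAt (fun q : V => ‖u q‖ ^ p)
      ((p * ‖u q‖ ^ (p - 2)) • (innerSL ℝ (u q)).comp (fderiv ℝ u q)) q :=
    (hasFDerivAt_norm_rpow (u q) (by linarith)).comp q (hu q).hasFDerivAt
  have hn : ‖q.1‖ ≠ 0 := by simpa using hq
  have h2 := ((hasFDerivAt_fst (𝕜 := ℝ) (p := q)).norm_sq).rpow_const (p := s / 2)
    (Or.inl (by positivity))
  have e2 : (fun x : V => (‖x.1‖ ^ 2) ^ (s / 2)) = fun x : V => ‖x.1‖ ^ s := by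
    funext x
    rw [← Real.rpow_natCast_mul (norm_nonneg _)]
    congr 1; push_cast; ring
  have h2' : HasFDerivAt (fun x : V => ‖x.1‖ ^ s) _ q := e2 ▸ h2
  have h3 : HasFDerivAt (fun q : V => ‖u q‖ ^ p * ‖q.1‖ ^ s) _ q := h1.mul h2'
  rw [h3.fderiv]
  have e3 : (‖q.1‖ ^ 2) ^ (s / 2 - 1) * ‖q.1‖ ^ 2 = ‖q.1‖ ^ s := by
    rw [← Real.rpow_add_one (by positivity), ← Real.rpow_natCast_mul (norm_nonneg _)]
    congr 1; push_cast; ring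
  simp
  rw [← e3]
  ring

end

/-- **Cylindrical Hardy inequality in `ℝ^N = ℝ^m × ℝ^{N-m}`** (Euclidean setting):
for `Ω ⊆ (ℝ^m \ {0}) × ℝ^{N-m}` open and `u ∈ C^∞_c(Ω;ℂ)`,
`∫_Ω |∇_ξ u·(ξ/|ξ|)|^p |ξ|^{-p(θ-1)} ≥ |(m-pθ)/p|^p ∫_Ω |u|^p |ξ|^{-pθ}`.
Here `k = N - m ≥ 1`, so `1 ≤ m < N`. -/
theorem hardy_cylindrical
    {m k : ℕ} (hm : 1 ≤ m) (hk : 1 ≤ k)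
    {p : ℝ} (hp : 2 ≤ p) (θ : ℝ)
    {Ω : Set (EuclideanSpace ℝ (Fin m) × EuclideanSpace ℝ (Fin k))} (hΩ : IsOpen Ω)
    (hΩ0 : Ω ⊆ {q : EuclideanSpace ℝ (Fin m) × EuclideanSpace ℝ (Fin k) | q.1 ≠ 0}) :
    ∀ u : EuclideanSpace ℝ (Fin m) × EuclideanSpace ℝ (Fin k) → ℂ,
      ContDiff ℝ (⊤ : ℕ∞) u → HasCompactSupport u → tsupport u ⊆ Ω →
      |((m : ℝ) - p * θ) / p| ^ p * ∫ q in Ω, ‖u q‖ ^ p * ‖q.1‖ ^ (-(p * θ))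
        ≤ ∫ q in Ω,
            ‖fderiv ℝ u q (‖q.1‖⁻¹ • q.1, (0 : EuclideanSpace ℝ (Fin k)))‖ ^ p *
              ‖q.1‖ ^ (-(p * (θ - 1))) := by
  intro u hu hc hsub
  have hu1 : ContDiff ℝ 1 u := hu.of_le (by exact_mod_cast le_top)
  have hud : Differentiable ℝ u := hu1.differentiable one_ne_zero
  have hufd : Continuous (fderiv ℝ u) := hu1.continuous_fderiv one_ne_zero
  have hp0 : 0 < p := by linarith
  have hne : ∀ q ∈ tsupport u, q.1 ≠ 0 := fun q hq => hΩ0 (hsub hq)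
  have hu0 : ∀ q, q ∉ tsupport u → u q = 0 := fun q hq => image_eq_zero_of_notMem_tsupport hq
  have hd0 : ∀ q, q ∉ tsupport u → fderiv ℝ u q = 0 := fun q hq =>
    fderiv_of_notMem_tsupport ℝ hq
  set s : ℝ := -(p * θ) with hs
  set F : EuclideanSpace ℝ (Fin m) × EuclideanSpace ℝ (Fin k) → ℝ :=
    fun q => ‖u q‖ ^ p * ‖q.1‖ ^ s with hFdef
  set g : EuclideanSpace ℝ (Fin m) × EuclideanSpace ℝ (Fin k) → ℝ :=
    fun q => ‖fderiv ℝ u q (q.1, 0)‖ ^ p * ‖q.1‖ ^ s with hgdef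
  have hF0 : ∀ q, q ∉ tsupport u → F q = 0 := fun q hq => by
    simp [hFdef, hu0 q hq, Real.zero_rpow hp0.ne']
  have hg0 : ∀ q, q ∉ tsupport u → g q = 0 := fun q hq => by
    simp [hgdef, hd0 q hq, Real.zero_rpow hp0.ne']
  have hFc : HasCompactSupport F := HasCompactSupport.intro hc hF0
  have hgc : HasCompactSupport g := HasCompactSupport.intro hc hg0
  have hF : ContDiff ℝ 1 F := by
    rw [contDiff_iff_contDiffAt]
    intro q
    by_cases hq : q ∈ tsupport u
    · refine (hu1.norm_rpow (by linarith)).contDiffAt.mul ?_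
      exact (contDiffAt_fst.norm ℝ (hne q hq)).rpow_const_of_ne (by simpa using hne q hq)
    · have : F =ᶠ[nhds q] fun _ => 0 := by
        filter_upwards [(isClosed_tsupport u).isOpen_compl.mem_nhds hq] with x hx using hF0 x hx
      exact contDiffAt_const.congr_of_eventuallyEq this
  have hg : Continuous g := by
    refine cont_aux (u := u) (fun q hq => ?_) hg0
    refine ContinuousAt.mul ?_ ?_
    · have : Continuous fun q : EuclideanSpace ℝ (Fin m) × EuclideanSpace ℝ (Fin k) =>
          ‖fderiv ℝ u q (q.1, 0)‖ :=
        (hufd.clm_apply (continuous_fst.prodMk continuous_const)).norm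
      exact (this.rpow_const (fun _ => Or.inr hp0.le)).continuousAt
    · exact continuous_fst.norm.continuousAt.rpow_const (Or.inl (by simpa using hne q hq))
  have hFi : Integrable F := hF.continuous.integrable_of_hasCompactSupport hFc
  have hgi : Integrable g := hg.integrable_of_hasCompactSupport hgc
  have hHi : Integrable (fun q => fderiv ℝ F q (q.1, 0)) := by
    apply Continuous.integrable_of_hasCompactSupport
    · exact (hF.continuous_fderiv one_ne_zero).clm_apply
        (continuous_fst.prodMk continuous_const)
    · refine HasCompactSupport.intro (hFc.fderiv ℝ) (fun q hq => ?_)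
      rw [image_eq_zero_of_notMem_tsupport hq]; simp
  have hI := euler_int F hF hFc
  -- rewrite both sides
  have eL : ∫ q in Ω, F q = ∫ q, F q :=
    setIntegral_eq_integral_of_forall_compl_eq_zero (fun q hq => hF0 q (fun h => hq (hsub h)))
  have eR : ∫ q in Ω, ‖fderiv ℝ u q (‖q.1‖⁻¹ • q.1, (0 : EuclideanSpace ℝ (Fin k)))‖ ^ p *
              ‖q.1‖ ^ (-(p * (θ - 1))) = ∫ q, g q := by
    rw [← setIntegral_eq_integral_of_forall_compl_eq_zero (s := Ω)
      (fun q hq => hg0 q (fun h => hq (hsub h)))]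
    refine setIntegral_congr_fun hΩ.measurableSet (fun q hq => ?_)
    have hq0 : 0 < ‖q.1‖ := norm_pos_iff.2 (hΩ0 hq)
    have e1 : ((‖q.1‖⁻¹ • q.1, 0) : EuclideanSpace ℝ (Fin m) × EuclideanSpace ℝ (Fin k))
        = ‖q.1‖⁻¹ • (q.1, 0) := by simp
    have e2 : -(p * (θ - 1)) = p + s := by rw [hs]; ring
    simp only [hgdef]
    rw [e1, map_smul, norm_smul, norm_inv, norm_norm, e2, Real.rpow_add hq0,
      Real.mul_rpow (by positivity) (by positivity), Real.inv_rpow hq0.le]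
    have : ‖q.1‖ ^ p ≠ 0 := by positivity
    field_simp
  rw [eL, eR]
  set c : ℝ := |((m : ℝ) - p * θ) / p| with hcdef
  have hc0 : 0 ≤ c := abs_nonneg _
  have hcp : |(m : ℝ) + s| = p * c := by
    rw [hcdef, abs_div, abs_of_pos hp0, hs]
    field_simp
    congr 1
  have hcc : c ^ (p - 1) * c = c ^ p := by
    rw [← Real.rpow_add_one' hc0 (by linarith)]; congr 1; ring
  have pt : ∀ q, c ^ (p - 1) * |fderiv ℝ F q (q.1, 0) - s * F q|
      ≤ (p - 1) * c ^ p * F q + g q := by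
    intro q
    by_cases hq : q ∈ tsupport u
    · rw [hFdef, deriv_aux hp hud (hne q hq), hgdef]
      simp only [add_sub_cancel_right]
      have hW : 0 ≤ ‖q.1‖ ^ s := by positivity
      have hin : |inner ℝ (u q) (fderiv ℝ u q (q.1, 0))| ≤ ‖u q‖ * ‖fderiv ℝ u q (q.1, 0)‖ :=
        abs_real_inner_le_norm _ _
      have hy := young_aux hp hc0 (norm_nonneg (u q)) (norm_nonneg (fderiv ℝ u q (q.1, 0)))
      have ha : ‖u q‖ ^ (p - 2) * ‖u q‖ = ‖u q‖ ^ (p - 1) := by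
        rw [← Real.rpow_add_one' (norm_nonneg _) (by linarith)]; congr 1; ring
      rw [abs_mul, abs_mul, abs_mul, abs_of_pos hp0, abs_of_nonneg hW,
        abs_of_nonneg (by positivity : 0 ≤ ‖u q‖ ^ (p - 2))]
      calc _ ≤ c ^ (p - 1) * (p * ‖u q‖ ^ (p - 2) * (‖u q‖ * ‖fderiv ℝ u q (q.1, 0)‖)
              * ‖q.1‖ ^ s) := by gcongr
        _ = p * (c ^ (p - 1) * (‖u q‖ ^ (p - 1) * ‖fderiv ℝ u q (q.1, 0)‖)) * ‖q.1‖ ^ s := by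
            rw [← ha]; ring
        _ ≤ ((p - 1) * (c ^ p * ‖u q‖ ^ p) + ‖fderiv ℝ u q (q.1, 0)‖ ^ p) * ‖q.1‖ ^ s := by
            gcongr
        _ = _ := by ring
    · have : F =ᶠ[nhds q] fun _ => 0 := by
        filter_upwards [(isClosed_tsupport u).isOpen_compl.mem_nhds hq] with x hx using hF0 x hx
      rw [this.fderiv_eq, hF0 q hq, hg0 q hq]
      simp
  have hDi : Integrable (fun q => fderiv ℝ F q (q.1, 0) - s * F q) := hHi.sub (hFi.const_mul s)
  have hint := integral_mono (hDi.abs.const_mul (c ^ (p - 1)))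
    ((hFi.const_mul ((p - 1) * c ^ p)).add hgi) pt
  simp only [Pi.add_apply] at hint
  rw [integral_const_mul, integral_add (hFi.const_mul _) hgi, integral_const_mul] at hint
  have hD : ∫ q, (fderiv ℝ F q (q.1, 0) - s * F q) = -((m + s) * ∫ q, F q) := by
    rw [integral_sub hHi (hFi.const_mul s), hI, integral_const_mul]; ring
  have hFn : 0 ≤ ∫ q, F q := integral_nonneg (fun q => by positivity)
  have habs := abs_integral_le_integral_abs
    (f := fun q => fderiv ℝ F q (q.1, 0) - s * F q) (μ := volume)
  rw [hD, abs_neg, abs_mul, abs_of_nonneg hFn, hcp] at habs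
  have h4 := mul_le_mul_of_nonneg_left habs (by positivity : 0 ≤ c ^ (p - 1))
  have h5 : c ^ (p - 1) * (p * c * ∫ q, F q) = p * (c ^ p * ∫ q, F q) := by
    rw [← hcc]; ring
  rw [h5] at h4
  nlinarith [h4.trans hint]
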